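/- Lemma F.2 (equivalence of G-invariant Gaussian purifications, covariance-matrix level): Let G be a group and let S_A : G → Matrix (2n_A×2n_A) ℝ and S_B : G → Matrix (2n_B×2n_B) ℝ be group homomorphisms with every S_A(g) and S_B(g) symplectic. Let n = n_A + n_B and let σ₁, σ₂ be (2n×2n) real symmetric positive-definite matrices that are pure with respect to Ω_n = Ω_{n_A} ⊕ Ω_{n_B} (σ_k * Ω_n * σ_k * Ω_n = −1), invariant ((S_A(g) ⊕ S_B(g)) * σ_k * (S_A(g) ⊕ S_B(g))ᵀ = σ_k for all g ∈ G, k = 1,2), and whose top-left 2n_A×2n_A blocks are equal. Then there exists a symplectic (2n_B×2n_B) matrix V_B commuting with S_B(g) for every g ∈ G such that (1_{2n_A} ⊕ V_B) * σ₁ * (1_{2n_A} ⊕ V_B)ᵀ = σ₂. -/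

import Mathlib

open Matrix

noncomputable section

/-- The 2×2 standard symplectic form `Ω₁ = !![0,1; -1,0]`. -/
def Omega1 : Matrix (Fin 2) (Fin 2) ℝ := !![0, 1; -1, 0]

/-- The 2n×2n standard symplectic form `Ω_n`, a block-diagonal matrix with `n` copies of `Ω₁`. -/
def OmegaN (n : ℕ) : Matrix (Fin 2 × Fin n) (Fin 2 × Fin n) ℝ :=
  Matrix.blockDiagonal fun _ => Omega1

/-- A real 2n×2n matrix is symplectic if `S * Ω_n * Sᵀ = Ω_n`. -/
def IsSymplectic {n : ℕ} (S : Matrix (Fin 2 × Fin n) (Fin 2 × Fin n) ℝ) : Prop :=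
  S * OmegaN n * Sᵀ = OmegaN n

/-- The symplectic form `Ω_{n_A} ⊕ Ω_{n_B}` on a composite system. -/
def OmegaAB (nA nB : ℕ) :
    Matrix ((Fin 2 × Fin nA) ⊕ (Fin 2 × Fin nB)) ((Fin 2 × Fin nA) ⊕ (Fin 2 × Fin nB)) ℝ :=
  Matrix.fromBlocks (OmegaN nA) 0 0 (OmegaN nB)

section Aux

variable {m n : Type*} [Fintype m] [DecidableEq m] [Fintype n] [DecidableEq n]

theorem aux_spectral (H : Matrix n n ℝ) (hH : Hᵀ = H) :
    ∃ (U : Matrix n n ℝ) (l : n → ℝ), U * Uᵀ = 1 ∧ Uᵀ * U = 1 ∧ H = U * diagonal l * Uᵀ := by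
  have hH' : H.IsHermitian := by
    rw [Matrix.IsHermitian, conjTranspose_eq_transpose_of_trivial, hH]
  refine ⟨hH'.eigenvectorUnitary, hH'.eigenvalues, ?_, ?_, ?_⟩
  · have := Unitary.coe_mul_star_self hH'.eigenvectorUnitary
    rwa [Unitary.coe_star, star_eq_conjTranspose, conjTranspose_eq_transpose_of_trivial] at this
  · have := Unitary.coe_star_mul_self hH'.eigenvectorUnitary
    rwa [star_eq_conjTranspose, conjTranspose_eq_transpose_of_trivial] at this
  · have := hH'.spectral_theorem
    rw [Unitary.conjStarAlgAut_apply, star_eq_conjTranspose,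
      conjTranspose_eq_transpose_of_trivial] at this
    exact this

theorem aux_posDef_iff (E : Matrix n n ℝ) (R R' : Matrix n n ℝ) (h : R * R' = 1) (l : n → ℝ)
    (hE : E = R * diagonal l * Rᵀ) : E.PosDef ↔ ∀ i, 0 < l i := by
  have h' : R' * R = 1 := mul_eq_one_comm.mp h
  have hu : IsUnit Rᵀ := by
    rw [isUnit_transpose]
    exact IsUnit.of_mul_eq_one _ h
  have e : diagonal l = R' * E * R'ᵀ := by
    have ht : Rᵀ * R'ᵀ = 1 := by rw [← transpose_mul, h', transpose_one]
    calc diagonal l = (R' * R) * diagonal l * (Rᵀ * R'ᵀ) := by rw [h', ht]; simp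
      _ = _ := by rw [hE]; simp only [Matrix.mul_assoc]
  rw [← posDef_diagonal_iff]
  constructor
  · intro H
    have := H.conjTranspose_mul_mul_same (B := R'ᵀ) (mulVec_injective_of_isUnit
      (by rw [isUnit_transpose]; exact IsUnit.of_mul_eq_one _ h'))
    rw [conjTranspose_eq_transpose_of_trivial, transpose_transpose, ← e] at this
    exact this
  · intro H
    have := H.conjTranspose_mul_mul_same (B := Rᵀ) (mulVec_injective_of_isUnit hu)
    rw [conjTranspose_eq_transpose_of_trivial, transpose_transpose, ← hE] at this
    exact this

theorem aux_posSemidef_iff (E : Matrix n n ℝ) (R R' : Matrix n n ℝ) (h : R * R' = 1) (l : n → ℝ)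
    (hE : E = R * diagonal l * Rᵀ) : E.PosSemidef ↔ ∀ i, 0 ≤ l i := by
  have h' : R' * R = 1 := mul_eq_one_comm.mp h
  have e : diagonal l = R' * E * R'ᵀ := by
    have ht : Rᵀ * R'ᵀ = 1 := by rw [← transpose_mul, h', transpose_one]
    calc diagonal l = (R' * R) * diagonal l * (Rᵀ * R'ᵀ) := by rw [h', ht]; simp
      _ = _ := by rw [hE]; simp only [Matrix.mul_assoc]
  rw [← posSemidef_diagonal_iff]
  constructor
  · intro H
    have := H.conjTranspose_mul_mul_same R'ᵀ
    rw [conjTranspose_eq_transpose_of_trivial, transpose_transpose, ← e] at this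
    exact this
  · intro H
    have := H.conjTranspose_mul_mul_same Rᵀ
    rw [conjTranspose_eq_transpose_of_trivial, transpose_transpose, ← hE] at this
    exact this

set_option linter.unusedSectionVars false in
theorem aux_symm {E : Matrix n n ℝ} (hE : E.PosDef) : Eᵀ = E := by
  have := hE.1
  rwa [Matrix.IsHermitian, conjTranspose_eq_transpose_of_trivial] at this

theorem aux_factor (E : Matrix n n ℝ) (hE : E.PosDef) :
    ∃ L L' : Matrix n n ℝ, L * L' = 1 ∧ L' * L = 1 ∧ E = L * Lᵀ := by
  obtain ⟨U, l, h1, h2, h3⟩ := aux_spectral E (aux_symm hE)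
  have hl := (aux_posDef_iff E U Uᵀ h1 l h3).1 hE
  have hs : diagonal (fun i => √(l i)) * diagonal (fun i => (√(l i))⁻¹) = (1 : Matrix n n ℝ) := by
    rw [diagonal_mul_diagonal, ← diagonal_one]
    congr 1; funext i
    exact mul_inv_cancel₀ (Real.sqrt_pos.2 (hl i)).ne'
  have hL : (U * diagonal (fun i => √(l i))) * (diagonal (fun i => (√(l i))⁻¹) * Uᵀ) = 1 := by
    calc _ = U * (diagonal (fun i => √(l i)) * diagonal (fun i => (√(l i))⁻¹)) * Uᵀ := by
          simp only [Matrix.mul_assoc]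
      _ = 1 := by rw [hs, Matrix.mul_one, h1]
  refine ⟨_, _, hL, mul_eq_one_comm.mp hL, ?_⟩
  rw [transpose_mul, diagonal_transpose, h3]
  have : diagonal l = diagonal (fun i => √(l i)) * diagonal (fun i => √(l i)) := by
    rw [diagonal_mul_diagonal]
    congr 1; funext i
    exact (Real.mul_self_sqrt (hl i).le).symm
  rw [this]
  simp only [Matrix.mul_assoc]

theorem aux_diag (E T : Matrix n n ℝ) (hE : E.PosDef) (hT : (T * E)ᵀ = T * E) :
    ∃ (R R' : Matrix n n ℝ) (l : n → ℝ), R * R' = 1 ∧ R' * R = 1 ∧ E = R * Rᵀ ∧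
      T = R * diagonal l * R' ∧ T * E = R * diagonal l * Rᵀ := by
  obtain ⟨L, L', h1, h2, h3⟩ := aux_factor E hE
  have h1t : L'ᵀ * Lᵀ = 1 := by rw [← transpose_mul, h1, transpose_one]
  have h2t : Lᵀ * L'ᵀ = 1 := by rw [← transpose_mul, h2, transpose_one]
  have hs : L' * T * L = L' * (T * E) * L'ᵀ := by
    calc L' * T * L = L' * T * L * (Lᵀ * L'ᵀ) := by rw [h2t, Matrix.mul_one]
      _ = _ := by rw [h3]; simp only [Matrix.mul_assoc]
  have hsym : (L' * T * L)ᵀ = L' * T * L := by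
    rw [hs, transpose_mul, transpose_mul, transpose_transpose, hT]
    simp only [Matrix.mul_assoc]
  obtain ⟨U, l, u1, u2, u3⟩ := aux_spectral _ hsym
  have hR : (L * U) * (Uᵀ * L') = 1 := by
    calc _ = L * (U * Uᵀ) * L' := by simp only [Matrix.mul_assoc]
      _ = 1 := by rw [u1, Matrix.mul_one, h1]
  have hTT : T = (L * U) * diagonal l * (Uᵀ * L') := by
    calc T = (L * L') * T * (L * L') := by rw [h1]; simp
      _ = L * (L' * T * L) * L' := by simp only [Matrix.mul_assoc]
      _ = _ := by rw [u3]; simp only [Matrix.mul_assoc]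
  have hEE : E = (L * U) * (L * U)ᵀ := by
    calc E = L * (U * Uᵀ) * Lᵀ := by rw [u1, h3, Matrix.mul_one]
      _ = _ := by rw [transpose_mul]; simp only [Matrix.mul_assoc]
  refine ⟨L * U, Uᵀ * L', l, hR, mul_eq_one_comm.mp hR, hEE, hTT, ?_⟩
  calc T * E = (L * U) * diagonal l * ((Uᵀ * L') * (L * U)) * (L * U)ᵀ := by
        conv_lhs => rw [hTT, hEE]
        simp only [Matrix.mul_assoc]
    _ = _ := by rw [mul_eq_one_comm.mp hR, Matrix.mul_one]

theorem aux_interp (s : Finset ℝ) (f : ℝ → ℝ) :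
    ∃ p : Polynomial ℝ, ∀ x ∈ s, p.eval x = f x := by
  refine ⟨Lagrange.interpolate s id f, fun x hx => ?_⟩
  exact Lagrange.eval_interpolate_at_node (v := id) f (Set.injOn_id _) hx

theorem aux_aeval_semiconj (X : Matrix m m ℝ) (Y : Matrix n n ℝ) (Z : Matrix m n ℝ)
    (h : X * Z = Z * Y) (p : Polynomial ℝ) :
    Polynomial.aeval X p * Z = Z * Polynomial.aeval Y p := by
  induction p using Polynomial.induction_on' with
  | add p q hp hq => rw [map_add, map_add, Matrix.add_mul, Matrix.mul_add, hp, hq]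
  | monomial k a =>
    have hk : X ^ k * Z = Z * Y ^ k := by
      induction k with
      | zero => simp
      | succ k ih => rw [pow_succ, pow_succ', Matrix.mul_assoc, h, ← Matrix.mul_assoc, ih,
          Matrix.mul_assoc, ← pow_succ, ← pow_succ']
    rw [Polynomial.aeval_monomial, Polynomial.aeval_monomial, ← Algebra.smul_def,
      ← Algebra.smul_def, Matrix.smul_mul, Matrix.mul_smul, hk]

theorem aux_aeval_diagonal (l : n → ℝ) (p : Polynomial ℝ) :
    Polynomial.aeval (diagonal l) p = diagonal (fun i => p.eval (l i)) := by
  induction p using Polynomial.induction_on' with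
  | add p q hp hq => rw [map_add, hp, hq, diagonal_add]; simp
  | monomial k a =>
    rw [Polynomial.aeval_monomial, ← Algebra.smul_def, diagonal_pow, ← diagonal_smul]
    congr 1; funext i; simp

theorem aux_aeval_conj (R R' : Matrix n n ℝ) (h : R' * R = 1) (l : n → ℝ) (p : Polynomial ℝ) :
    Polynomial.aeval (R * diagonal l * R') p = R * diagonal (fun i => p.eval (l i)) * R' := by
  rw [← aux_aeval_diagonal]
  have h1 : R * R' = 1 := mul_eq_one_comm.mp h
  have := aux_aeval_semiconj (R * diagonal l * R') (diagonal l) R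
    (by rw [Matrix.mul_assoc, h, Matrix.mul_one]) p
  rw [← this, Matrix.mul_assoc _ R R', h1, Matrix.mul_one]

theorem aux_aeval_transpose (T : Matrix n n ℝ) (p : Polynomial ℝ) :
    Polynomial.aeval Tᵀ p = (Polynomial.aeval T p)ᵀ := by
  induction p using Polynomial.induction_on' with
  | add p q hp hq => rw [map_add, map_add, hp, hq, transpose_add]
  | monomial k a =>
    rw [Polynomial.aeval_monomial, Polynomial.aeval_monomial, ← Algebra.smul_def,
      ← Algebra.smul_def, transpose_smul, transpose_pow]

/-- Uniqueness of positive square roots with respect to the inner product given by `E`. -/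
theorem aux_sqrt_unique (E T Q : Matrix n n ℝ) (hE : E.PosDef) (hT : (T * E).PosSemidef)
    (hQ : (Q * E).PosSemidef) (h : T * T = Q * Q) : T = Q := by
  have key : ∀ X : Matrix n n ℝ, (X * E).PosSemidef → ∃ s : Finset ℝ, ∀ p : Polynomial ℝ,
      (∀ x ∈ s, p.eval x = √x) → Polynomial.aeval (X * X) p = X := by
    intro X hX
    have hXs : (X * E)ᵀ = X * E := by
      have := hX.1
      rwa [Matrix.IsHermitian, conjTranspose_eq_transpose_of_trivial] at this
    obtain ⟨R, R', l, h1, h2, h3, h4, h5⟩ := aux_diag E X hE hXs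
    have hl := (aux_posSemidef_iff _ R R' h1 l h5).1 hX
    refine ⟨Finset.univ.image (fun i => l i * l i), fun p hp => ?_⟩
    have hXX : X * X = R * diagonal (fun i => l i * l i) * R' := by
      rw [← diagonal_mul_diagonal]
      calc X * X = R * diagonal l * (R' * R) * diagonal l * R' := by
            conv_lhs => rw [h4]
            simp only [Matrix.mul_assoc]
        _ = _ := by rw [h2, Matrix.mul_one]; simp only [Matrix.mul_assoc]
    rw [hXX, aux_aeval_conj R R' h2]
    conv_rhs => rw [h4]
    congr 3
    funext i
    rw [hp _ (Finset.mem_image_of_mem _ (Finset.mem_univ i)), Real.sqrt_mul_self (hl i)]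
  obtain ⟨s, hs⟩ := key T hT
  obtain ⟨t, ht⟩ := key Q hQ
  obtain ⟨p, hp⟩ := aux_interp (s ∪ t) Real.sqrt
  rw [← hs p (fun x hx => hp x (Finset.mem_union_left _ hx)),
    ← ht p (fun x hx => hp x (Finset.mem_union_right _ hx)), h]

/-- Polar decomposition of `P * W`, through a polynomial. -/
theorem aux_polar (P W : Matrix n n ℝ) (hP : P.PosDef) (hW : Wᵀ = -W) (hW2 : W * W = -1) :
    ∃ s : Finset ℝ, ∀ p : Polynomial ℝ, (∀ x ∈ s, p.eval x = (√x)⁻¹) →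
      (Polynomial.aeval (-(P * W * (P * W))) p * P).PosDef ∧
      (Polynomial.aeval (-(P * W * (P * W))) p * P) * W *
        (Polynomial.aeval (-(P * W * (P * W))) p * P) = W := by
  have hPs := aux_symm hP
  set M := -(P * W * (P * W)) with hM
  have e : M * P = (W * P)ᴴ * P * (W * P) := by
    rw [conjTranspose_eq_transpose_of_trivial, transpose_mul, hW, hPs, hM]
    simp only [Matrix.mul_assoc, Matrix.mul_neg, Matrix.neg_mul]
  have hinj : Function.Injective (W * P).mulVec := by
    apply mulVec_injective_of_isUnit
    refine IsUnit.mul (IsUnit.of_mul_eq_one (-W) ?_) hP.isUnit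
    rw [Matrix.mul_neg, hW2, neg_neg]
  have hpd : (M * P).PosDef := by
    rw [e]; exact hP.conjTranspose_mul_mul_same hinj
  obtain ⟨R, R', l, h1, h2, h3, h4, h5⟩ := aux_diag P M hP (aux_symm hpd)
  have hl := (aux_posDef_iff _ R R' h1 l h5).1 hpd
  refine ⟨Finset.univ.image l, fun p hp => ?_⟩
  have hQ : Polynomial.aeval M p = R * diagonal (fun i => (√(l i))⁻¹) * R' := by
    conv_lhs => rw [h4]
    rw [aux_aeval_conj R R' h2]
    congr 3
    funext i
    exact hp _ (Finset.mem_image_of_mem _ (Finset.mem_univ i))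
  have hcomm : Polynomial.aeval M p * (P * W) = (P * W) * Polynomial.aeval M p := by
    apply aux_aeval_semiconj
    rw [hM]; simp only [Matrix.mul_assoc, Matrix.mul_neg, Matrix.neg_mul]
  constructor
  · refine (aux_posDef_iff _ R R' h1 (fun i => (√(l i))⁻¹) ?_).2 fun i => ?_
    · calc Polynomial.aeval M p * P
          = R * diagonal (fun i => (√(l i))⁻¹) * (R' * R) * Rᵀ := by
            rw [hQ]; conv_lhs => rw [h3]
            simp only [Matrix.mul_assoc]
        _ = _ := by rw [h2, Matrix.mul_one]
    · exact inv_pos.2 (Real.sqrt_pos.2 (hl i))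
  · have hQQ : Polynomial.aeval M p * Polynomial.aeval M p * M = 1 := by
      have hd : diagonal (fun i => (√(l i))⁻¹) * diagonal (fun i => (√(l i))⁻¹) * diagonal l
          = (1 : Matrix n n ℝ) := by
        rw [diagonal_mul_diagonal, diagonal_mul_diagonal, ← diagonal_one]
        congr 1; funext i
        have := (Real.sqrt_pos.2 (hl i)).ne'
        field_simp
        exact (Real.sq_sqrt (hl i).le).symm
      calc Polynomial.aeval M p * Polynomial.aeval M p * M
          = R * diagonal (fun i => (√(l i))⁻¹) * (R' * R) * diagonal (fun i => (√(l i))⁻¹)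
              * (R' * R) * diagonal l * R' := by
            rw [hQ]; conv_lhs => rw [h4]
            simp only [Matrix.mul_assoc]
        _ = R * (diagonal (fun i => (√(l i))⁻¹) * diagonal (fun i => (√(l i))⁻¹)
              * diagonal l) * R' := by
            rw [h2]; simp only [Matrix.mul_assoc, Matrix.mul_one, Matrix.one_mul]
        _ = 1 := by rw [hd, Matrix.mul_one, h1]
    set Q := Polynomial.aeval M p
    have h6 : (Q * P) * W * (Q * P) * W = -1 := by
      calc (Q * P) * W * (Q * P) * W = Q * ((P * W) * Q) * (P * W) := by
            simp only [Matrix.mul_assoc]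
        _ = Q * Q * ((P * W) * (P * W)) := by rw [← hcomm]; simp only [Matrix.mul_assoc]
        _ = -(Q * Q * M) := by rw [hM, Matrix.mul_neg, neg_neg]
        _ = -1 := by rw [hQQ]
    calc (Q * P) * W * (Q * P) = -((Q * P) * W * (Q * P) * (W * W)) := by
          rw [hW2]; simp
      _ = -((Q * P) * W * (Q * P) * W * W) := by simp only [Matrix.mul_assoc]
      _ = W := by rw [h6]; simp

end Aux

section Core

variable {m n : Type*} [Fintype m] [DecidableEq m] [Fintype n] [DecidableEq n]

theorem aux_stab (V E W : Matrix n n ℝ) (hW2 : W * W = -1) (hV : V * W * Vᵀ = W)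
    (hc : V * (E * W) = (E * W) * V) : V * E * Vᵀ = E := by
  have hE : E = -(E * W * W) := by rw [Matrix.mul_assoc, hW2]; simp
  calc V * E * Vᵀ = -(V * (E * W) * (W * Vᵀ)) := by
        conv_lhs => rw [hE]
        simp only [Matrix.mul_assoc, Matrix.mul_neg, Matrix.neg_mul]
    _ = -((E * W) * (V * W * Vᵀ)) := by rw [hc]; simp only [Matrix.mul_assoc]
    _ = E := by rw [hV]; exact hE.symm

section Exp
open scoped Matrix.Norms.Operator

theorem aux_exp_symplectic (X W : Matrix n n ℝ) (hW2 : W * W = -1) (hX : W * Xᵀ = -(X * W)) :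
    NormedSpace.exp X * W * (NormedSpace.exp X)ᵀ = W := by
  have hinv : W⁻¹ = -W := Matrix.inv_eq_right_inv (by rw [Matrix.mul_neg, hW2, neg_neg])
  have hu : IsUnit W := IsUnit.of_mul_eq_one (-W) (by rw [Matrix.mul_neg, hW2, neg_neg])
  have h1 := Matrix.exp_conj W Xᵀ hu
  have h2 : W * Xᵀ * W⁻¹ = -X := by
    rw [hX, hinv, Matrix.neg_mul, Matrix.mul_neg, neg_neg, Matrix.mul_assoc, hW2]; simp
  rw [h2, Matrix.exp_transpose] at h1
  have h3 : W * (NormedSpace.exp X)ᵀ = NormedSpace.exp (-X) * W := by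
    rw [h1, Matrix.mul_assoc, hinv, Matrix.neg_mul, hW2]; simp
  have h4 : NormedSpace.exp X * NormedSpace.exp (-X) = 1 := by
    rw [Matrix.exp_neg]
    exact Matrix.mul_nonsing_inv _ ((Matrix.isUnit_iff_isUnit_det _).1 (Matrix.isUnit_exp X))
  rw [Matrix.mul_assoc, h3, ← Matrix.mul_assoc, h4, Matrix.one_mul]

theorem aux_first_order (X T : Matrix n n ℝ)
    (h : ∀ t : ℝ, (NormedSpace.exp (t • X) * T).trace ≤ T.trace) : (X * T).trace = 0 := by
  have h1 : HasDerivAt (fun u : ℝ => NormedSpace.exp (u • X)) X 0 := by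
    have := hasDerivAt_exp_smul_const (𝕂 := ℝ) X 0
    simp only [zero_smul, NormedSpace.exp_zero, one_mul] at this
    exact this
  let L : Matrix n n ℝ →ₗ[ℝ] ℝ :=
    (Matrix.traceLinearMap n ℝ ℝ) ∘ₗ (LinearMap.mulRight ℝ T)
  have h2 : HasDerivAt (fun u : ℝ => L (NormedSpace.exp (u • X))) (L X) 0 := by
    exact (LinearMap.toContinuousLinearMap L).hasFDerivAt.comp_hasDerivAt 0 h1
  have h3 : IsLocalMax (fun u : ℝ => L (NormedSpace.exp (u • X))) 0 := by
    refine Filter.Eventually.of_forall fun u => ?_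
    simpa [L] using h u
  exact h3.hasDerivAt_eq_zero h2

theorem aux_exp_comm (X Y : Matrix n n ℝ) (h : X * Y = Y * X) (t : ℝ) :
    NormedSpace.exp (t • X) * Y = Y * NormedSpace.exp (t • X) := by
  have : Commute Y (t • X) := (show Commute Y X from h.symm).smul_right t
  exact this.exp_right.eq.symm

end Exp

theorem aux_core {ι : Type*} (O At : Matrix m m ℝ) (W E : Matrix n n ℝ) (C₁ C₂ : Matrix m n ℝ)
    (S : ι → Matrix n n ℝ)
    (hO : Oᵀ = -O) (hO2 : O * O = -1) (hW : Wᵀ = -W) (hW2 : W * W = -1)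
    (hAt : At.PosDef) (hE : E.PosDef)
    (h₁ : C₁ * W * E = -(At * O * C₁)) (h₂ : C₂ * W * E = -(At * O * C₂))
    (hcd : C₁ * W * C₁ᵀ = C₂ * W * C₂ᵀ)
    (hS₁ : ∀ g, (C₁ᵀ * O * C₂ * W) * S g = S g * (C₁ᵀ * O * C₂ * W))
    (hS₂ : ∀ g, (C₂ᵀ * O * C₁ * W) * S g = S g * (C₂ᵀ * O * C₁ * W))
    (hmax : ∀ V : Matrix n n ℝ, V * W * Vᵀ = W → (∀ g, V * S g = S g * V) → V * E * Vᵀ = E →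
      (V * (C₁ᵀ * O * C₂ * W)).trace ≤ (C₁ᵀ * O * C₂ * W).trace) : C₁ = C₂ := by
  have hEs := aux_symm hE
  have hAs := aux_symm hAt
  -- transposed intertwining relations
  have tr : ∀ C : Matrix m n ℝ, C * W * E = -(At * O * C) → E * W * Cᵀ = -(Cᵀ * O * At) := by
    intro C h
    have := congrArg Matrix.transpose h
    simp only [transpose_mul, transpose_neg, hW, hO, hEs, hAs, Matrix.mul_neg, Matrix.neg_mul,
      neg_neg] at this
    rw [← Matrix.mul_assoc, ← Matrix.mul_assoc] at this
    rw [← this, neg_neg]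
  have comm : ∀ C D : Matrix m n ℝ, C * W * E = -(At * O * C) → D * W * E = -(At * O * D) →
      (Cᵀ * O * D * W) * (E * W) = (E * W) * (Cᵀ * O * D * W) := by
    intro C D hC hD
    calc (Cᵀ * O * D * W) * (E * W) = Cᵀ * O * (D * W * E) * W := by
          simp only [Matrix.mul_assoc]
      _ = -(Cᵀ * O * At) * O * D * W := by
          rw [hD]; simp only [Matrix.mul_assoc, Matrix.mul_neg, Matrix.neg_mul]
      _ = _ := by rw [← tr C hC]; simp only [Matrix.mul_assoc]
  set T := C₁ᵀ * O * C₂ * W with hT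
  set T2 := C₂ᵀ * O * C₁ * W with hT2
  have hcT : T * (E * W) = (E * W) * T := comm _ _ h₁ h₂
  have hcT2 : T2 * (E * W) = (E * W) * T2 := comm _ _ h₂ h₁
  have dag : ∀ C D : Matrix m n ℝ, W * (Cᵀ * O * D * W)ᵀ = (Dᵀ * O * C * W) * W := by
    intro C D
    simp only [transpose_mul, transpose_transpose, hW, hO, Matrix.mul_neg, Matrix.neg_mul,
      neg_neg, Matrix.mul_assoc, hW2]
    rw [← Matrix.mul_assoc W W, hW2]
    simp
  have hd1 : W * Tᵀ = T2 * W := dag _ _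
  have hd2 : W * T2ᵀ = T * W := dag _ _
  -- first order condition
  have hTT : T = T2 := by
    set X := T - T2 with hX
    have hXW : W * Xᵀ = -(X * W) := by
      rw [hX, transpose_sub, Matrix.mul_sub, hd1, hd2, Matrix.sub_mul, neg_sub]
    have hXE : X * (E * W) = (E * W) * X := by
      rw [hX, Matrix.sub_mul, Matrix.mul_sub, hcT, hcT2]
    have hXS : ∀ g, X * S g = S g * X := by
      intro g
      rw [hX, Matrix.sub_mul, Matrix.mul_sub, hS₁, hS₂]
    have t1 : (X * T).trace = 0 := by
      apply aux_first_order
      intro t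
      have hs := aux_exp_symplectic (t • X) W hW2
        (by rw [transpose_smul, Matrix.mul_smul, hXW, Matrix.smul_mul, smul_neg])
      exact hmax _ hs (fun g => aux_exp_comm _ _ (hXS g) t)
        (aux_stab _ _ _ hW2 hs (aux_exp_comm _ _ hXE t))
    have t2 : (X * T2).trace = 0 := by
      have e : T2 = -(W * Tᵀ * W) := by
        rw [hd1, Matrix.mul_assoc, hW2]; simp
      have : X * T2 = W * (Xᵀ * Tᵀ * W) := by
        calc X * T2 = -(X * W) * (Tᵀ * W) := by
              rw [e]; simp only [Matrix.mul_assoc, Matrix.mul_neg, Matrix.neg_mul]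
          _ = _ := by rw [← hXW]; simp only [Matrix.mul_assoc]
      rw [this, trace_mul_comm, Matrix.mul_assoc, hW2, Matrix.mul_neg, Matrix.mul_one,
        ← transpose_mul, trace_neg, trace_transpose, trace_mul_comm, t1, neg_zero]
    have t3 : (X * X).trace = 0 := by
      conv_lhs => rw [show X * X = X * T - X * T2 by rw [← Matrix.mul_sub]]
      rw [trace_sub, t1, t2, sub_zero]
    obtain ⟨L, L', l1, l2, l3⟩ := aux_factor E hE
    have hEX : X * E = -(E * Xᵀ) := by
      calc X * E = -(X * (E * W) * W) := by
            simp only [Matrix.mul_assoc, hW2, Matrix.mul_neg, Matrix.mul_one, neg_neg]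
        _ = -(E * W * (X * W)) := by rw [hXE]; simp only [Matrix.mul_assoc]
        _ = E * W * (W * Xᵀ) := by rw [hXW, Matrix.mul_neg]
        _ = E * (W * W) * Xᵀ := by simp only [Matrix.mul_assoc]
        _ = -(E * Xᵀ) := by rw [hW2]; simp
    have hY : (L' * X * L) * (L' * X * L)ᵀ = -(L' * (X * X) * L) := by
      have l2t : Lᵀ * L'ᵀ = 1 := by rw [← transpose_mul, l2, transpose_one]
      calc (L' * X * L) * (L' * X * L)ᵀ = L' * X * ((L * Lᵀ) * Xᵀ) * L'ᵀ := by
            simp only [transpose_mul, Matrix.mul_assoc]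
        _ = -(L' * X * (X * E) * L'ᵀ) := by
            rw [← l3, hEX]; simp only [Matrix.mul_neg, Matrix.neg_mul, neg_neg]
        _ = -(L' * (X * X) * L * (Lᵀ * L'ᵀ)) := by
            rw [l3]; simp only [Matrix.mul_assoc]
        _ = _ := by rw [l2t, Matrix.mul_one]
    have hY0 : L' * X * L = 0 := by
      rw [← trace_mul_conjTranspose_self_eq_zero_iff, conjTranspose_eq_transpose_of_trivial, hY,
        trace_neg, trace_mul_comm, ← Matrix.mul_assoc, l1, Matrix.one_mul, t3, neg_zero]
    have : X = 0 := by
      calc X = (L * L') * X * (L * L') := by rw [l1]; simp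
        _ = L * (L' * X * L) * L' := by simp only [Matrix.mul_assoc]
        _ = 0 := by rw [hY0]; simp
    exact sub_eq_zero.1 this
  -- positivity
  rw [← hTT] at hd1
  have hTE : T * E = E * Tᵀ := by
    calc T * E = -(T * (E * W) * W) := by
          simp only [Matrix.mul_assoc, hW2, Matrix.mul_neg, Matrix.mul_one, neg_neg]
      _ = -(E * W * (T * W)) := by rw [hcT]; simp only [Matrix.mul_assoc]
      _ = -(E * (W * W) * Tᵀ) := by rw [← hd1]; simp only [Matrix.mul_assoc]
      _ = E * Tᵀ := by rw [hW2]; simp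
  have hTpsd : (T * E).PosSemidef := by
    obtain ⟨R, R', l, r1, r2, r3, r4, r5⟩ := aux_diag E T hE
      (by rw [transpose_mul, hEs, hTE])
    rw [aux_posSemidef_iff _ R R' r1 l r5]
    obtain ⟨p, hp⟩ := aux_interp (Finset.univ.image l) (fun x => if x < 0 then -1 else 1)
    have hp' : ∀ i, p.eval (l i) = if l i < 0 then -1 else 1 := fun i =>
      hp _ (Finset.mem_image_of_mem _ (Finset.mem_univ i))
    have hV : Polynomial.aeval T p = R * diagonal (fun i => p.eval (l i)) * R' := by
      conv_lhs => rw [r4]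
      rw [aux_aeval_conj R R' r2]
    have hVW : Polynomial.aeval T p * W = W * (Polynomial.aeval T p)ᵀ := by
      rw [← aux_aeval_transpose]
      exact aux_aeval_semiconj _ _ _ hd1.symm p
    have hVE := aux_aeval_semiconj _ _ _ hcT p
    have hVS := fun g => aux_aeval_semiconj _ _ _ (hS₁ g) p
    have hVE : Polynomial.aeval T p * (E * W) = (E * W) * Polynomial.aeval T p := hVE
    have hVV : Polynomial.aeval T p * Polynomial.aeval T p = 1 := by
      rw [hV]
      have : diagonal (fun i => p.eval (l i)) * diagonal (fun i => p.eval (l i))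
          = (1 : Matrix n n ℝ) := by
        rw [diagonal_mul_diagonal, ← diagonal_one]
        congr 1; funext i
        rw [hp']; split_ifs <;> norm_num
      calc _ = R * diagonal (fun i => p.eval (l i)) * (R' * R) *
            diagonal (fun i => p.eval (l i)) * R' := by simp only [Matrix.mul_assoc]
        _ = R * (diagonal (fun i => p.eval (l i)) * diagonal (fun i => p.eval (l i))) * R' := by
            rw [r2, Matrix.mul_one]; simp only [Matrix.mul_assoc]
        _ = 1 := by rw [this, Matrix.mul_one, r1]
    have hVs : Polynomial.aeval T p * W * (Polynomial.aeval T p)ᵀ = W := by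
      rw [Matrix.mul_assoc, ← hVW, ← Matrix.mul_assoc, hVV, Matrix.one_mul]
    have hm := hmax _ hVs hVS (aux_stab _ _ _ hW2 hVs hVE)
    have e1 : (Polynomial.aeval T p * T).trace = ∑ i, p.eval (l i) * l i := by
      have : Polynomial.aeval T p * T = R * (diagonal (fun i => p.eval (l i) * l i) * R') := by
        rw [hV]
        conv_lhs => rw [r4]
        rw [← diagonal_mul_diagonal]
        calc _ = R * diagonal (fun i => p.eval (l i)) * (R' * R) * diagonal l * R' := by
              simp only [Matrix.mul_assoc]
          _ = _ := by rw [r2, Matrix.mul_one]; simp only [Matrix.mul_assoc]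
      rw [this, trace_mul_comm, Matrix.mul_assoc, r2, Matrix.mul_one, trace_diagonal]
    have e2 : T.trace = ∑ i, l i := by
      conv_lhs => rw [r4]
      rw [trace_mul_comm, ← Matrix.mul_assoc, r2, Matrix.one_mul, trace_diagonal]
    rw [e1, e2] at hm
    have hle : ∀ i ∈ Finset.univ, l i ≤ p.eval (l i) * l i := by
      intro i _
      rw [hp']; split_ifs <;> linarith
    have heq := (Finset.sum_eq_sum_iff_of_le hle).1 (le_antisymm (Finset.sum_le_sum hle) hm)
    intro i
    have := heq i (Finset.mem_univ i)
    rw [hp'] at this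
    split_ifs at this <;> linarith
  have quad : ∀ C : Matrix m n ℝ, C * W * E = -(At * O * C) →
      (Cᵀ * O * C * W) * E = (O * C)ᵀ * At * (O * C) := by
    intro C hC
    calc (Cᵀ * O * C * W) * E = Cᵀ * O * (C * W * E) := by simp only [Matrix.mul_assoc]
      _ = _ := by
        rw [hC, transpose_mul, hO]
        simp only [Matrix.mul_assoc, Matrix.mul_neg, Matrix.neg_mul]
  have psd : ∀ C : Matrix m n ℝ, C * W * E = -(At * O * C) →
      ((Cᵀ * O * C * W) * E).PosSemidef := by
    intro C hC
    rw [quad C hC, ← conjTranspose_eq_transpose_of_trivial]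
    exact hAt.posSemidef.conjTranspose_mul_mul_same _
  have q1 : T = C₁ᵀ * O * C₁ * W := by
    refine aux_sqrt_unique E _ _ hE hTpsd (psd _ h₁) ?_
    calc T * T = T * T2 := by rw [← hTT]
      _ = C₁ᵀ * O * (C₂ * W * C₂ᵀ) * O * C₁ * W := by simp only [hT, hT2, Matrix.mul_assoc]
      _ = _ := by rw [← hcd]; simp only [Matrix.mul_assoc]
  have q2 : T = C₂ᵀ * O * C₂ * W := by
    refine aux_sqrt_unique E _ _ hE hTpsd (psd _ h₂) ?_
    calc T * T = T2 * T := by rw [← hTT]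
      _ = C₂ᵀ * O * (C₁ * W * C₁ᵀ) * O * C₂ * W := by simp only [hT, hT2, Matrix.mul_assoc]
      _ = _ := by rw [hcd]; simp only [Matrix.mul_assoc]
  have hD : (C₁ - C₂) * W * E = -(At * O * (C₁ - C₂)) := by
    rw [Matrix.sub_mul, Matrix.sub_mul, h₁, h₂, Matrix.mul_sub]; abel
  have hz : (C₁ - C₂)ᵀ * O * (C₁ - C₂) * W = 0 := by
    have : (C₁ - C₂)ᵀ * O * (C₁ - C₂) * W
        = C₁ᵀ * O * C₁ * W - T2 - (T - C₂ᵀ * O * C₂ * W) := by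
      simp only [transpose_sub, Matrix.sub_mul, Matrix.mul_sub, hT, hT2]
    rw [this, ← q1, ← q2, ← hTT]; simp
  obtain ⟨L, L', l1, l2, l3⟩ := aux_factor At hAt
  have hz2 : (Lᵀ * (O * (C₁ - C₂)))ᵀ * (Lᵀ * (O * (C₁ - C₂))) = 0 := by
    have := quad _ hD
    rw [hz, Matrix.zero_mul, l3] at this
    rw [this, transpose_mul, transpose_transpose]
    simp only [Matrix.mul_assoc]
  rw [← conjTranspose_eq_transpose_of_trivial, conjTranspose_mul_self_eq_zero] at hz2
  have l1t : L'ᵀ * Lᵀ = 1 := by rw [← transpose_mul, l1, transpose_one]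
  have : C₁ - C₂ = 0 := by
    calc C₁ - C₂ = -(O * O * (C₁ - C₂)) := by rw [hO2]; simp
      _ = -(O * (L'ᵀ * Lᵀ) * (O * (C₁ - C₂))) := by rw [l1t]; simp only [Matrix.mul_assoc, Matrix.mul_one]
      _ = -(O * L'ᵀ * (Lᵀ * (O * (C₁ - C₂)))) := by simp only [Matrix.mul_assoc]
      _ = 0 := by rw [hz2]; simp
  exact sub_eq_zero.1 this

end Core

section Final

variable {m n : Type*} [Fintype m] [DecidableEq m] [Fintype n] [DecidableEq n]

theorem aux_symp_inv (V W : Matrix n n ℝ) (hW2 : W * W = -1) (hV : V * W * Vᵀ = W) :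
    V * (-(W * Vᵀ * W)) = 1 ∧ (-(W * Vᵀ * W)) * V = 1 ∧ Vᵀ * W * V = W := by
  have h1 : V * (-(W * Vᵀ * W)) = 1 := by
    calc V * (-(W * Vᵀ * W)) = -(V * W * Vᵀ * W) := by
          simp only [Matrix.mul_assoc, Matrix.mul_neg]
      _ = 1 := by rw [hV, hW2, neg_neg]
  have h2 := mul_eq_one_comm.mp h1
  refine ⟨h1, h2, ?_⟩
  calc Vᵀ * W * V = -((W * W) * Vᵀ * W * V) := by rw [hW2]; simp
    _ = W * ((-(W * Vᵀ * W)) * V) := by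
        simp only [Matrix.mul_assoc, Matrix.mul_neg, Matrix.neg_mul]
    _ = W := by rw [h2, Matrix.mul_one]

theorem aux_max {ι : Type*} (E₁ E₂ W M V₀ : Matrix n n ℝ) (S : ι → Matrix n n ℝ)
    (hE₁ : E₁.PosDef)
    (h0 : V₀ * W * V₀ᵀ = W ∧ (∀ g, V₀ * S g = S g * V₀) ∧ V₀ * E₁ * V₀ᵀ = E₂) :
    ∃ V : Matrix n n ℝ, (V * W * Vᵀ = W ∧ (∀ g, V * S g = S g * V) ∧ V * E₁ * Vᵀ = E₂) ∧
      ∀ V' : Matrix n n ℝ,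
        (V' * W * V'ᵀ = W ∧ (∀ g, V' * S g = S g * V') ∧ V' * E₁ * V'ᵀ = E₂) →
        (V' * M).trace ≤ (V * M).trace := by
  obtain ⟨L, L', l1, l2, l3⟩ := aux_factor E₁ hE₁
  let K : Set (Matrix n n ℝ) :=
    {V | V * W * Vᵀ = W ∧ (∀ g, V * S g = S g * V) ∧ V * E₁ * Vᵀ = E₂}
  have hclosed : IsClosed K := by
    have e : K = {V | V * W * Vᵀ = W} ∩ (⋂ g, {V | V * S g = S g * V}) ∩
        {V | V * E₁ * Vᵀ = E₂} := by
      ext V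
      simp only [K, Set.mem_setOf_eq, Set.mem_inter_iff, Set.mem_iInter, and_assoc]
    rw [e]
    refine IsClosed.inter (IsClosed.inter ?_ (isClosed_iInter fun g => ?_)) ?_
    · exact isClosed_eq (by fun_prop) (by fun_prop)
    · exact isClosed_eq (by fun_prop) (by fun_prop)
    · exact isClosed_eq (by fun_prop) (by fun_prop)
  let B : Set (Matrix n n ℝ) :=
    Set.pi Set.univ fun i => Set.pi Set.univ fun _ => Set.Icc (-(1 + E₂ i i)) (1 + E₂ i i)
  have hB : IsCompact B :=
    isCompact_univ_pi fun i => isCompact_univ_pi fun _ => isCompact_Icc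
  have hB' : IsCompact ((fun Z : Matrix n n ℝ => Z * L') '' B) :=
    hB.image (by fun_prop)
  have hsub : K ⊆ (fun Z : Matrix n n ℝ => Z * L') '' B := by
    rintro V ⟨-, -, hV⟩
    refine ⟨V * L, ?_, ?_⟩
    · have hZ : (V * L) * (V * L)ᵀ = E₂ := by
        rw [← hV, l3, transpose_mul]; simp only [Matrix.mul_assoc]
      intro i _ j _
      have h1 : E₂ i i = ∑ k, (V * L) i k * (V * L) i k := by
        rw [← hZ, Matrix.mul_apply]; rfl
      have h2 : (V * L) i j * (V * L) i j ≤ E₂ i i := by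
        rw [h1]
        exact Finset.single_le_sum (f := fun k => (V * L) i k * (V * L) i k)
          (fun k _ => mul_self_nonneg _) (Finset.mem_univ j)
      constructor
      · nlinarith [sq_nonneg ((V * L) i j + 1)]
      · nlinarith [sq_nonneg ((V * L) i j - 1)]
    · change V * L * L' = V
      rw [Matrix.mul_assoc, l1, Matrix.mul_one]
  have hK : IsCompact K := hB'.of_isClosed_subset hclosed hsub
  obtain ⟨V, hV, hmax⟩ := hK.exists_isMaxOn ⟨V₀, h0⟩
    (f := fun V : Matrix n n ℝ => (V * M).trace)
    (Continuous.continuousOn (by fun_prop))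
  exact ⟨V, hV, fun V' hV' => hmax hV'⟩

theorem aux_align {ι : Type*} (E₁ E₂ W : Matrix n n ℝ) (S : ι → Matrix n n ℝ)
    (hW : Wᵀ = -W) (hW2 : W * W = -1)
    (hE₁ : E₁.PosDef) (hE₂ : E₂.PosDef) (hp₁ : E₁ * W * E₁ = W) (hp₂ : E₂ * W * E₂ = W)
    (hS₁ : ∀ g, E₁ * W * S g = S g * (E₁ * W)) (hS₂ : ∀ g, E₂ * W * S g = S g * (E₂ * W)) :
    ∃ V : Matrix n n ℝ, V * W * Vᵀ = W ∧ (∀ g, V * S g = S g * V) ∧ V * E₁ * Vᵀ = E₂ := by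
  obtain ⟨s, hs⟩ := aux_polar (E₁ + E₂) W (hE₁.add hE₂) hW hW2
  obtain ⟨p, hp⟩ := aux_interp s (fun x => (√x)⁻¹)
  obtain ⟨h1, h2⟩ := hs p hp
  set X := (E₁ + E₂) * W with hX
  set Q := Polynomial.aeval (-(X * X)) p with hQ
  have hXj : X = E₁ * W + E₂ * W := by rw [hX, Matrix.add_mul]
  have j1 : (E₁ * W) * (E₁ * W) = -1 := by rw [← Matrix.mul_assoc, hp₁, hW2]
  have j2 : (E₂ * W) * (E₂ * W) = -1 := by rw [← Matrix.mul_assoc, hp₂, hW2]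
  have x1 : X * (E₁ * W) = (E₂ * W) * X := by
    rw [hXj, Matrix.add_mul, Matrix.mul_add, j1, j2, add_comm]
  have x2 : X * (E₂ * W) = (E₁ * W) * X := by
    rw [hXj, Matrix.add_mul, Matrix.mul_add, j1, j2, add_comm]
  have hQc : ∀ Y : Matrix n n ℝ, X * X * Y = Y * (X * X) → Q * Y = Y * Q := by
    intro Y hY
    apply aux_aeval_semiconj
    rw [Matrix.neg_mul, hY, Matrix.mul_neg]
  have hQj : Q * (E₂ * W) = (E₂ * W) * Q := by
    apply hQc
    rw [Matrix.mul_assoc, x2, ← Matrix.mul_assoc, x1, Matrix.mul_assoc]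
  have hXS : ∀ g, X * S g = S g * X := by
    intro g
    rw [hXj, Matrix.add_mul, Matrix.mul_add, hS₁, hS₂]
  have hQS : ∀ g, Q * S g = S g * Q := by
    intro g
    apply hQc
    rw [Matrix.mul_assoc, hXS, ← Matrix.mul_assoc, hXS, Matrix.mul_assoc]
  have hEs := aux_symm h1
  have hVs : (Q * X) * W * (Q * X)ᵀ = W := by
    have e : Q * X = Q * (E₁ + E₂) * W := by rw [hX, Matrix.mul_assoc]
    rw [e, transpose_mul, hEs, hW]
    calc _ = -(Q * (E₁ + E₂) * (W * W) * W * (Q * (E₁ + E₂))) := by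
          simp only [Matrix.mul_assoc, Matrix.mul_neg, Matrix.neg_mul]
      _ = Q * (E₁ + E₂) * W * (Q * (E₁ + E₂)) := by
          rw [hW2]; simp only [Matrix.mul_neg, Matrix.neg_mul, neg_neg, Matrix.mul_one]
      _ = W := h2
  refine ⟨Q * X, hVs, ?_, ?_⟩
  · intro g
    rw [Matrix.mul_assoc, hXS, ← Matrix.mul_assoc, hQS, Matrix.mul_assoc]
  · have hv : (Q * X) * (E₁ * W) = (E₂ * W) * (Q * X) := by
      rw [Matrix.mul_assoc, x1, ← Matrix.mul_assoc, hQj, Matrix.mul_assoc]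
    calc (Q * X) * E₁ * (Q * X)ᵀ = -((Q * X) * E₁ * (W * W) * (Q * X)ᵀ) := by rw [hW2]; simp
      _ = -(((Q * X) * (E₁ * W)) * W * (Q * X)ᵀ) := by simp only [Matrix.mul_assoc]
      _ = -((E₂ * W) * ((Q * X) * W * (Q * X)ᵀ)) := by
          rw [hv]; simp only [Matrix.mul_assoc]
      _ = E₂ := by rw [hVs, Matrix.mul_assoc, hW2]; simp

theorem aux_main {ι : Type*} (O A : Matrix m m ℝ) (W B₁ B₂ : Matrix n n ℝ)
    (C₁ C₂ : Matrix m n ℝ) (SA : ι → Matrix m m ℝ) (SB : ι → Matrix n n ℝ)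
    (hO : Oᵀ = -O) (hO2 : O * O = -1) (hW : Wᵀ = -W) (hW2 : W * W = -1)
    (hA : A.PosDef) (hB₁ : B₁.PosDef) (hB₂ : B₂.PosDef)
    (hAA₁ : A * O * A * O + C₁ * W * C₁ᵀ * O = -1)
    (hAA₂ : A * O * A * O + C₂ * W * C₂ᵀ * O = -1)
    (hAB₁ : A * O * C₁ * W + C₁ * W * B₁ * W = 0)
    (hAB₂ : A * O * C₂ * W + C₂ * W * B₂ * W = 0)
    (hBB₁ : C₁ᵀ * O * C₁ * W + B₁ * W * B₁ * W = -1)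
    (hBB₂ : C₂ᵀ * O * C₂ * W + B₂ * W * B₂ * W = -1)
    (hSA : ∀ g, SA g * O * (SA g)ᵀ = O) (hSB : ∀ g, SB g * W * (SB g)ᵀ = W)
    (hSC₁ : ∀ g, SA g * C₁ * (SB g)ᵀ = C₁) (hSC₂ : ∀ g, SA g * C₂ * (SB g)ᵀ = C₂)
    (hSB₁ : ∀ g, SB g * B₁ * (SB g)ᵀ = B₁) (hSB₂ : ∀ g, SB g * B₂ * (SB g)ᵀ = B₂) :
    ∃ V : Matrix n n ℝ, V * W * Vᵀ = W ∧ (∀ g, V * SB g = SB g * V) ∧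
      C₁ * Vᵀ = C₂ ∧ V * B₁ * Vᵀ = B₂ := by
  have hcd : C₁ * W * C₁ᵀ = C₂ * W * C₂ᵀ := by
    have h := add_left_cancel (hAA₁.trans hAA₂.symm)
    have h' := congrArg (· * O) h
    simp only [Matrix.mul_assoc, hO2, Matrix.mul_neg, Matrix.mul_one, neg_inj] at h'
    simpa only [Matrix.mul_assoc] using h'
  have hac : ∀ (C : Matrix m n ℝ) (B : Matrix n n ℝ), A * O * C * W + C * W * B * W = 0 →
      A * O * C = -(C * W * B) := by
    intro C B h
    have h' := congrArg (· * W) (eq_neg_of_add_eq_zero_left h)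
    simp only [Matrix.mul_assoc, hW2, Matrix.mul_neg, Matrix.neg_mul, Matrix.mul_one,
      neg_neg] at h'
    simp only [Matrix.mul_assoc, ← h', neg_neg]
  have hac₁ := hac _ _ hAB₁
  have hac₂ := hac _ _ hAB₂
  obtain ⟨sA, psA⟩ := aux_polar A O hA hO hO2
  obtain ⟨s₁, ps₁⟩ := aux_polar B₁ W hB₁ hW hW2
  obtain ⟨s₂, ps₂⟩ := aux_polar B₂ W hB₂ hW hW2
  obtain ⟨p, hp⟩ := aux_interp (sA ∪ (s₁ ∪ s₂)) (fun x => (√x)⁻¹)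
  obtain ⟨hAt, -⟩ := psA p fun x hx => hp x (by simp [hx])
  obtain ⟨hE₁, hp₁⟩ := ps₁ p fun x hx => hp x (by simp [hx])
  obtain ⟨hE₂, hp₂⟩ := ps₂ p fun x hx => hp x (by simp [hx])
  have inter : ∀ (C : Matrix m n ℝ) (B : Matrix n n ℝ), A * O * C = -(C * W * B) →
      C * W * (Polynomial.aeval (-(B * W * (B * W))) p * B) =
        -(Polynomial.aeval (-(A * O * (A * O))) p * A * O * C) := by
    intro C B h
    have h1 : (-(A * O * (A * O))) * (C * W) = (C * W) * (-(B * W * (B * W))) := by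
      calc (-(A * O * (A * O))) * (C * W) = -(A * O * (A * O * C) * W) := by
            simp only [Matrix.mul_assoc, Matrix.neg_mul]
        _ = (A * O * C) * W * B * W := by
            rw [h]; simp only [Matrix.mul_assoc, Matrix.neg_mul, Matrix.mul_neg, neg_neg]
            rw [← Matrix.mul_assoc O C, ← Matrix.mul_assoc A]
            rw [← Matrix.mul_assoc A O C, h]
            simp only [Matrix.mul_assoc, Matrix.neg_mul]
        _ = _ := by rw [h]; simp only [Matrix.mul_assoc, Matrix.neg_mul, Matrix.mul_neg]
    have h2 := aux_aeval_semiconj _ _ _ h1 p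
    rw [← Matrix.mul_assoc, ← h2]
    calc _ = Polynomial.aeval (-(A * O * (A * O))) p * (C * W * B) := by
          rw [Matrix.mul_assoc _ (C * W) B]
      _ = Polynomial.aeval (-(A * O * (A * O))) p * (-(A * O * C)) := by rw [h, neg_neg]
      _ = _ := by rw [Matrix.mul_neg]; simp only [Matrix.mul_assoc]
  have i₁ := inter _ _ hac₁
  have i₂ := inter _ _ hac₂
  have hbS : ∀ (B : Matrix n n ℝ), (∀ g, SB g * B * (SB g)ᵀ = B) → ∀ g,
      B * W * SB g = SB g * (B * W) := by
    intro B h g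
    obtain ⟨-, -, h3⟩ := aux_symp_inv _ _ hW2 (hSB g)
    calc B * W * SB g = SB g * B * ((SB g)ᵀ * W * SB g) := by
          conv_lhs => rw [← h g]
          simp only [Matrix.mul_assoc]
      _ = _ := by rw [h3]; simp only [Matrix.mul_assoc]
  have hES : ∀ (B : Matrix n n ℝ), (∀ g, SB g * B * (SB g)ᵀ = B) → ∀ g,
      Polynomial.aeval (-(B * W * (B * W))) p * B * W * SB g =
        SB g * (Polynomial.aeval (-(B * W * (B * W))) p * B * W) := by
    intro B h g
    have h1 := hbS B h g
    have h2 : (-(B * W * (B * W))) * SB g = SB g * (-(B * W * (B * W))) := by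
      rw [Matrix.neg_mul, Matrix.mul_assoc (B * W) (B * W), h1, ← Matrix.mul_assoc (B * W) (SB g),
        h1, Matrix.mul_neg, Matrix.mul_assoc (SB g)]
    have h3 := aux_aeval_semiconj _ _ _ h2 p
    rw [Matrix.mul_assoc _ B W, Matrix.mul_assoc, h1, ← Matrix.mul_assoc, h3, Matrix.mul_assoc]
  set QA := Polynomial.aeval (-(A * O * (A * O))) p with hQA
  set Q₁ := Polynomial.aeval (-(B₁ * W * (B₁ * W))) p with hQ₁
  set Q₂ := Polynomial.aeval (-(B₂ * W * (B₂ * W))) p with hQ₂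
  obtain ⟨V₀, hV₀⟩ := aux_align (Q₁ * B₁) (Q₂ * B₂) W SB hW hW2 hE₁ hE₂ hp₁ hp₂
    (hES _ hSB₁) (hES _ hSB₂)
  obtain ⟨V, ⟨hVs, hVS, hVE⟩, hmax⟩ := aux_max (Q₁ * B₁) (Q₂ * B₂) W (C₁ᵀ * O * C₂ * W) V₀ SB
    hE₁ hV₀
  obtain ⟨v1, v2, v3⟩ := aux_symp_inv V W hW2 hVs
  -- commutation of cross terms with the group
  have hcross : ∀ C D : Matrix m n ℝ, (∀ g, SA g * C * (SB g)ᵀ = C) →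
      (∀ g, SA g * D * (SB g)ᵀ = D) → ∀ g,
      Cᵀ * O * D * W * SB g = SB g * (Cᵀ * O * D * W) := by
    intro C D hC hD g
    obtain ⟨-, -, a3⟩ := aux_symp_inv _ _ hO2 (hSA g)
    obtain ⟨-, -, b3⟩ := aux_symp_inv _ _ hW2 (hSB g)
    have e1 : D * W * SB g = SA g * D * W := by
      calc D * W * SB g = SA g * D * ((SB g)ᵀ * W * SB g) := by
            conv_lhs => rw [← hD g]
            simp only [Matrix.mul_assoc]
        _ = _ := by rw [b3]
    have e2 : Cᵀ * O * SA g = SB g * Cᵀ * O := by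
      have : Cᵀ = SB g * Cᵀ * (SA g)ᵀ := by
        conv_lhs => rw [← hC g]
        simp only [transpose_mul, transpose_transpose, Matrix.mul_assoc]
      calc Cᵀ * O * SA g = SB g * Cᵀ * ((SA g)ᵀ * O * SA g) := by
            conv_lhs => rw [this]
            simp only [Matrix.mul_assoc]
        _ = _ := by rw [a3]
    calc Cᵀ * O * D * W * SB g = Cᵀ * O * (D * W * SB g) := by simp only [Matrix.mul_assoc]
      _ = Cᵀ * O * SA g * (D * W) := by rw [e1]; simp only [Matrix.mul_assoc]
      _ = _ := by rw [e2]; simp only [Matrix.mul_assoc]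
  have hC : C₁ * Vᵀ = C₂ := by
    have et : (C₁ * Vᵀ)ᵀ * O * C₂ * W = V * (C₁ᵀ * O * C₂ * W) := by
      rw [transpose_mul, transpose_transpose]; simp only [Matrix.mul_assoc]
    have et2 : C₂ᵀ * O * (C₁ * Vᵀ) * W = (C₂ᵀ * O * C₁ * W) * (-(W * Vᵀ * W)) := by
      calc C₂ᵀ * O * (C₁ * Vᵀ) * W = -(C₂ᵀ * O * C₁ * (W * W) * Vᵀ * W) := by
            rw [hW2]; simp [Matrix.mul_assoc]
        _ = _ := by simp only [Matrix.mul_assoc, Matrix.mul_neg]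
    have hV'S : ∀ g, (-(W * Vᵀ * W)) * SB g = SB g * (-(W * Vᵀ * W)) := by
      intro g
      calc (-(W * Vᵀ * W)) * SB g = (-(W * Vᵀ * W)) * (SB g * V) * (-(W * Vᵀ * W)) := by
            rw [Matrix.mul_assoc _ (SB g * V), Matrix.mul_assoc (SB g), v1, Matrix.mul_one]
        _ = _ := by rw [← hVS, ← Matrix.mul_assoc _ V, v2, Matrix.one_mul]
    refine aux_core O (QA * A) W (Q₂ * B₂) (C₁ * Vᵀ) C₂ SB hO hO2 hW hW2 hAt hE₂ ?_ i₂ ?_ ?_ ?_ ?_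
    · calc C₁ * Vᵀ * W * (Q₂ * B₂) = C₁ * (Vᵀ * W * V) * (Q₁ * B₁) * Vᵀ := by
            rw [← hVE]; simp only [Matrix.mul_assoc]
        _ = -(QA * A * O * C₁) * Vᵀ := by rw [v3, i₁]
        _ = _ := by simp only [Matrix.mul_assoc, Matrix.neg_mul]
    · calc C₁ * Vᵀ * W * (C₁ * Vᵀ)ᵀ = C₁ * (Vᵀ * W * V) * C₁ᵀ := by
            rw [transpose_mul, transpose_transpose]; simp only [Matrix.mul_assoc]
        _ = _ := by rw [v3, hcd]
    · intro g
      rw [et, Matrix.mul_assoc, hcross _ _ hSC₁ hSC₂, ← Matrix.mul_assoc, hVS, Matrix.mul_assoc]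
    · intro g
      rw [et2, Matrix.mul_assoc, hV'S, ← Matrix.mul_assoc, hcross _ _ hSC₂ hSC₁,
        Matrix.mul_assoc]
    · intro U hU hUS hUE
      rw [et, ← Matrix.mul_assoc]
      refine hmax (U * V) ⟨?_, ?_, ?_⟩
      · calc U * V * W * (U * V)ᵀ = U * (V * W * Vᵀ) * Uᵀ := by
              rw [transpose_mul]; simp only [Matrix.mul_assoc]
          _ = W := by rw [hVs, hU]
      · intro g
        rw [Matrix.mul_assoc, hVS, ← Matrix.mul_assoc, hUS, Matrix.mul_assoc]
      · calc U * V * (Q₁ * B₁) * (U * V)ᵀ = U * (V * (Q₁ * B₁) * Vᵀ) * Uᵀ := by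
              rw [transpose_mul]; simp only [Matrix.mul_assoc]
          _ = _ := by rw [hVE, hUE]
  refine ⟨V, hVs, hVS, hC, ?_⟩
  have m₁ : -(B₁ * W * (B₁ * W)) = 1 + C₁ᵀ * O * C₁ * W := by
    have : B₁ * W * (B₁ * W) = -1 - C₁ᵀ * O * C₁ * W := by
      rw [← hBB₁]; simp only [Matrix.mul_assoc]; abel
    rw [this]; abel
  have m₂ : -(B₂ * W * (B₂ * W)) = 1 + C₂ᵀ * O * C₂ * W := by
    have : B₂ * W * (B₂ * W) = -1 - C₂ᵀ * O * C₂ * W := by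
      rw [← hBB₂]; simp only [Matrix.mul_assoc]; abel
    rw [this]; abel
  have hQV : Q₂ * V = V * Q₁ := by
    apply aux_aeval_semiconj
    rw [m₁, m₂, Matrix.add_mul, Matrix.mul_add, Matrix.one_mul, Matrix.mul_one]
    congr 1
    rw [← hC, transpose_mul, transpose_transpose]
    calc _ = V * C₁ᵀ * O * C₁ * (Vᵀ * W * V) := by simp only [Matrix.mul_assoc]
      _ = _ := by rw [v3]; simp only [Matrix.mul_assoc]
  have hu : IsUnit Q₂ := isUnit_of_mul_isUnit_left hE₂.isUnit
  apply hu.mul_left_cancel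
  calc Q₂ * (V * B₁ * Vᵀ) = (Q₂ * V) * B₁ * Vᵀ := by simp only [Matrix.mul_assoc]
    _ = V * (Q₁ * B₁) * Vᵀ := by rw [hQV]; simp only [Matrix.mul_assoc]
    _ = Q₂ * B₂ := hVE

end Final

theorem aux_OmegaN_transpose (n : ℕ) : (OmegaN n)ᵀ = -OmegaN n := by
  rw [OmegaN, blockDiagonal_transpose, ← blockDiagonal_neg]
  congr 1
  funext k
  ext i j
  fin_cases i <;> fin_cases j <;> simp [Omega1]

theorem aux_OmegaN_sq (n : ℕ) : OmegaN n * OmegaN n = -1 := by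
  rw [OmegaN, ← blockDiagonal_mul, ← blockDiagonal_one, ← blockDiagonal_neg]
  congr 1
  funext k
  ext i j
  fin_cases i <;> fin_cases j <;> simp [Omega1]

/-- Lemma F.2: two `G`-invariant pure Gaussian covariance matrices on a composite system `AB`
with equal reduced covariance matrices on `A` are related by a `G`-invariant symplectic
transformation on `B` alone. -/
theorem invariant_purification_equivalence (nA nB : ℕ) {G : Type} [Group G]
    (SA : G → Matrix (Fin 2 × Fin nA) (Fin 2 × Fin nA) ℝ)
    (SB : G → Matrix (Fin 2 × Fin nB) (Fin 2 × Fin nB) ℝ)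
    (hSA1 : SA 1 = 1) (hSAmul : ∀ g h : G, SA (g * h) = SA g * SA h)
    (hSB1 : SB 1 = 1) (hSBmul : ∀ g h : G, SB (g * h) = SB g * SB h)
    (hSAsymp : ∀ g, IsSymplectic (SA g)) (hSBsymp : ∀ g, IsSymplectic (SB g))
    (σ₁ σ₂ : Matrix ((Fin 2 × Fin nA) ⊕ (Fin 2 × Fin nB))
      ((Fin 2 × Fin nA) ⊕ (Fin 2 × Fin nB)) ℝ)
    (hσ₁symm : σ₁.IsSymm) (hσ₁pd : σ₁.PosDef)
    (hσ₂symm : σ₂.IsSymm) (hσ₂pd : σ₂.PosDef)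
    (hσ₁pure : σ₁ * OmegaAB nA nB * σ₁ * OmegaAB nA nB = -1)
    (hσ₂pure : σ₂ * OmegaAB nA nB * σ₂ * OmegaAB nA nB = -1)
    (hσ₁inv : ∀ g, (Matrix.fromBlocks (SA g) 0 0 (SB g)) * σ₁ *
        (Matrix.fromBlocks (SA g) 0 0 (SB g))ᵀ = σ₁)
    (hσ₂inv : ∀ g, (Matrix.fromBlocks (SA g) 0 0 (SB g)) * σ₂ *
        (Matrix.fromBlocks (SA g) 0 0 (SB g))ᵀ = σ₂)
    (hblock : σ₁.toBlocks₁₁ = σ₂.toBlocks₁₁) :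
    ∃ VB : Matrix (Fin 2 × Fin nB) (Fin 2 × Fin nB) ℝ, IsSymplectic VB ∧
      (∀ g, VB * SB g = SB g * VB) ∧
      (Matrix.fromBlocks 1 0 0 VB) * σ₁ * (Matrix.fromBlocks 1 0 0 VB)ᵀ = σ₂ := by
  obtain ⟨A, C₁, D₁, B₁, rfl⟩ : ∃ A C D B, σ₁ = Matrix.fromBlocks A C D B :=
    ⟨_, _, _, _, (fromBlocks_toBlocks σ₁).symm⟩
  obtain ⟨A₂, C₂, D₂, B₂, rfl⟩ : ∃ A C D B, σ₂ = Matrix.fromBlocks A C D B :=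
    ⟨_, _, _, _, (fromBlocks_toBlocks σ₂).symm⟩
  rw [toBlocks_fromBlocks₁₁, toBlocks_fromBlocks₁₁] at hblock
  subst hblock
  rw [Matrix.IsSymm, fromBlocks_transpose, fromBlocks_inj] at hσ₁symm hσ₂symm
  obtain ⟨-, -, hD₁, -⟩ := hσ₁symm
  obtain ⟨-, -, hD₂, -⟩ := hσ₂symm
  subst hD₁ hD₂
  have e1 : (-1 : Matrix ((Fin 2 × Fin nA) ⊕ (Fin 2 × Fin nB))
      ((Fin 2 × Fin nA) ⊕ (Fin 2 × Fin nB)) ℝ) = fromBlocks (-1) 0 0 (-1) := by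
    rw [← fromBlocks_one, fromBlocks_neg, neg_zero, neg_zero]
  simp only [OmegaAB, e1, fromBlocks_multiply, fromBlocks_inj, Matrix.mul_zero, Matrix.zero_mul,
    add_zero, zero_add] at hσ₁pure hσ₂pure
  simp only [fromBlocks_transpose, fromBlocks_multiply, fromBlocks_inj, Matrix.mul_zero,
    Matrix.zero_mul, add_zero, zero_add, transpose_zero] at hσ₁inv hσ₂inv
  have hA : A.PosDef := by
    have := hσ₁pd.submatrix (e := Sum.inl) Sum.inl_injective
    exact this
  have hB₁ : B₁.PosDef := by
    have := hσ₁pd.submatrix (e := Sum.inr) Sum.inr_injective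
    exact this
  have hB₂ : B₂.PosDef := by
    have := hσ₂pd.submatrix (e := Sum.inr) Sum.inr_injective
    exact this
  obtain ⟨p1, p2, p3, p4⟩ := hσ₁pure
  obtain ⟨q1, q2, q3, q4⟩ := hσ₂pure
  simp only [Matrix.add_mul] at p1 p2 p3 p4 q1 q2 q3 q4
  obtain ⟨V, hV, hVS, hVC, hVB⟩ := aux_main (OmegaN nA) A (OmegaN nB) B₁ B₂ C₁ C₂ SA SB
    (aux_OmegaN_transpose _) (aux_OmegaN_sq _) (aux_OmegaN_transpose _) (aux_OmegaN_sq _)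
    hA hB₁ hB₂ p1 q1 p2 q2 p4 q4 hSAsymp hSBsymp (fun g => (hσ₁inv g).2.1)
    (fun g => (hσ₂inv g).2.1) (fun g => (hσ₁inv g).2.2.2) (fun g => (hσ₂inv g).2.2.2)
  refine ⟨V, hV, hVS, ?_⟩
  simp only [fromBlocks_transpose, fromBlocks_multiply, fromBlocks_inj, Matrix.mul_zero,
    Matrix.zero_mul, add_zero, zero_add, transpose_zero, transpose_one, Matrix.one_mul,
    Matrix.mul_one]
  refine ⟨trivial, hVC, ?_, hVB⟩
  rw [← hVC, transpose_mul, transpose_transpose]
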